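/- arXiv:2206.00194 — 4 statements merged into one kernel-verified Lean document; each statement's English description precedes it below -/
import Mathlib

section
/- Let 𝔤 be a finite-dimensional simple Lie algebra over ℂ. Then the ℂ-vector space of alternating bilinear maps f : 𝔤 × 𝔤 → 𝔤 satisfying the invariance condition f([z,x],y) + f(x,[z,y]) = [z, f(x,y)] for all x, y, z ∈ 𝔤 is one-dimensional, spanned by the Lie bracket (x,y) ↦ [x,y]. -/
/-- The Lie bracket of a Lie algebra over `R` as an `R`-bilinear map. -/
def bracketBilin (R L : Type*) [CommRing R] [LieRing L] [LieAlgebra R L] :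
    L →ₗ[R] L →ₗ[R] L :=
  LinearMap.mk₂ R (fun x y => ⁅x, y⁆)
    (fun _ _ _ => by simp) (fun _ _ _ => by simp)
    (fun _ _ _ => by simp) (fun _ _ _ => by simp)

/-- The `R`-module of alternating `R`-bilinear maps `f : L × L → L` satisfying the
invariance condition `f([z,x],y) + f(x,[z,y]) = [z, f(x,y)]`. -/
def invAltMaps (R L : Type*) [CommRing R] [LieRing L] [LieAlgebra R L] :
    Submodule R (L →ₗ[R] L →ₗ[R] L) where
  carrier := {f | (∀ x, f x x = 0) ∧
    ∀ (z x y : L), f ⁅z, x⁆ y + f x ⁅z, y⁆ = ⁅z, f x y⁆}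
  add_mem' := by
    rintro f g ⟨hf1, hf2⟩ ⟨hg1, hg2⟩
    refine ⟨fun x => by simp [hf1 x, hg1 x], fun z x y => ?_⟩
    simp only [LinearMap.add_apply, lie_add]
    rw [← hf2 z x y, ← hg2 z x y]
    abel
  zero_mem' := ⟨fun x => rfl, fun z x y => by simp⟩
  smul_mem' := by
    rintro c f ⟨hf1, hf2⟩
    refine ⟨fun x => by simp [hf1 x], fun z x y => ?_⟩
    simp only [LinearMap.smul_apply, lie_smul]
    rw [← hf2 z x y, smul_add]

open LieAlgebra LieAlgebra.IsKilling LieModule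

lemma bracketBilin_mem_invAltMaps (R L : Type*) [CommRing R] [LieRing L] [LieAlgebra R L] :
    bracketBilin R L ∈ invAltMaps R L :=
  ⟨fun x => lie_self x, fun z x y => (leibniz_lie z x y).symm⟩

namespace invAltMaps

section CommRing

variable {R L : Type*} [CommRing R] [LieRing L] [LieAlgebra R L] {f : L →ₗ[R] L →ₗ[R] L}

lemma apply_swap (hf : f ∈ invAltMaps R L) (x y : L) : f x y = -f y x :=
  (LinearMap.IsAlt.neg (B := f) hf.1 y x).symm

/-- The left kernel of an invariant alternating map, as an ideal. -/
def leftKer (hf : f ∈ invAltMaps R L) : LieIdeal R L where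
  __ := LinearMap.ker f
  lie_mem {z x} hx := by
    have hx : f x = 0 := hx
    refine LinearMap.ext fun y => ?_
    simpa [hx] using hf.2 z x y

lemma mem_leftKer (hf : f ∈ invAltMaps R L) {x : L} : x ∈ leftKer hf ↔ f x = 0 :=
  Iff.rfl

end CommRing

section IsKilling

variable {K L : Type*} [Field K] [CharZero K] [LieRing L] [LieAlgebra K L]
  [FiniteDimensional K L] [IsKilling K L] {H : LieSubalgebra K L} [H.IsCartanSubalgebra]
  [IsTriangularizable K H L] {f : L →ₗ[K] L →ₗ[K] L}

lemma lie_coe_eq_smul {α : H → K} {e : L} (he : e ∈ rootSpace H α) (h : H) :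
    ⁅(h : L), e⁆ = α h • e :=
  lie_eq_smul_of_mem_rootSpace he h

lemma lie_coe_eq_neg_smul {α : H → K} {e : L} (he : e ∈ rootSpace H α) (h : H) :
    ⁅e, (h : L)⁆ = -(α h • e) := by
  rw [← lie_skew, lie_coe_eq_smul he]

omit [CharZero K] [IsTriangularizable K H L] in
lemma lie_coe_coe (h h' : H) : ⁅(h : L), (h' : L)⁆ = 0 := by
  rw [← LieSubalgebra.coe_bracket, trivial_lie_zero, ZeroMemClass.coe_zero]

lemma apply_mem_rootSpace (hf : f ∈ invAltMaps K L) {α : H → K} {e : L}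
    (he : e ∈ rootSpace H α) (h : H) : f h e ∈ rootSpace H α := by
  refine weightSpace_le_genWeightSpace L α ((mem_weightSpace _ _).2 fun k => ?_)
  change ⁅(k : L), f h e⁆ = _
  rw [← hf.2, lie_coe_coe, lie_coe_eq_smul he]
  simp

lemma exists_apply_eq_smul (hf : f ∈ invAltMaps K L) {α : Weight K H L} (hα : α.IsNonZero)
    {e : L} (he : e ∈ rootSpace H α) (he₀ : e ≠ 0) (h : H) : ∃ c : K, f h e = c • e := by
  obtain ⟨c, hc⟩ := (finrank_eq_one_iff_of_nonzero' (⟨e, he⟩ : rootSpace H α)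
    (by simpa using he₀)).1 (finrank_rootSpace_eq_one α hα) ⟨f h e, apply_mem_rootSpace hf he h⟩
  exact ⟨c, (congrArg Subtype.val hc).symm⟩

lemma exists_apply_coroot_eq_smul (hf : f ∈ invAltMaps K L) (α : Weight K H L)
    (hα : α.IsNonZero) (h : H) : ∃ c : K, f h (coroot α) = c • (coroot α : L) := by
  obtain ⟨t, e, e', ht, he, he'⟩ := exists_isSl2Triple_of_weight_isNonZero hα
  obtain rfl := ht.h_eq_coroot hα he he'
  obtain ⟨a, ha⟩ := exists_apply_eq_smul hf hα he ht.e_ne_zero h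
  obtain ⟨b, hb⟩ := exists_apply_eq_smul hf hα.neg (e := e') he' ht.f_ne_zero h
  have h₁ := hf.2 e h e'
  have h₂ := hf.2 e' h e
  rw [lie_coe_eq_neg_smul he, ht.lie_e_f, hb, lie_smul, ht.lie_e_f] at h₁
  rw [lie_coe_eq_neg_smul he', ← lie_skew, ht.lie_e_f, ha, lie_smul, ← lie_skew,
    ht.lie_e_f] at h₂
  simp only [map_neg, map_smul, LinearMap.neg_apply, LinearMap.smul_apply, Pi.neg_apply,
    apply_swap hf e' e] at h₁ h₂
  refine ⟨(a + b) / 2, ?_⟩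
  linear_combination (norm := module) (1 / 2 : K) • h₁ - (1 / 2 : K) • h₂

lemma apply_coroot_coroot (hf : f ∈ invAltMaps K L) (α β : Weight K H L)
    (hα : α.IsNonZero) (hβ : β.IsNonZero) : f (coroot α) (coroot β) = 0 := by
  obtain ⟨a, ha⟩ := exists_apply_coroot_eq_smul hf β hβ (coroot α)
  obtain ⟨b, hb⟩ := exists_apply_coroot_eq_smul hf α hα (coroot β)
  by_cases ha₀ : a = 0
  · simp [ha, ha₀]
  · have hβ' : (coroot β : L) = (a⁻¹ * -b) • (coroot α : L) := by
      rw [mul_smul, neg_smul, ← hb, ← apply_swap hf, ha, smul_smul, inv_mul_cancel₀ ha₀, one_smul]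
    rw [hβ', map_smul, hf.1, smul_zero]

lemma apply_coe_coe (hf : f ∈ invAltMaps K L) (h h' : H) : f h h' = 0 := by
  have hspan := RootPairing.IsRootSystem.span_coroot_eq_top (P := rootSystem H)
  have key : (f.compl₁₂ H.toSubmodule.subtype H.toSubmodule.subtype) = 0 := by
    refine LinearMap.ext_on_range hspan fun α => LinearMap.ext_on_range hspan fun β => ?_
    exact apply_coroot_coroot hf α.1 β.1 (LieSubalgebra.isNonZero_coe_root α)
      (LieSubalgebra.isNonZero_coe_root β)
  exact LinearMap.congr_fun₂ key h h'

/-- On each root space, an invariant alternating map agrees with a multiple of the bracket. -/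
lemma exists_apply_eq_smul_lie (hf : f ∈ invAltMaps K L) (α : Weight K H L)
    (hα : α.IsNonZero) :
    ∃ c : K, ∀ h : H, ∀ e ∈ rootSpace H α, f h e = c • ⁅(h : L), e⁆ := by
  obtain ⟨e, he, he₀⟩ := α.exists_ne_zero
  obtain ⟨a, ha⟩ := exists_apply_eq_smul hf hα he he₀ (coroot α)
  refine ⟨a / 2, fun h x hx => ?_⟩
  obtain ⟨c, hc⟩ := (finrank_eq_one_iff_of_nonzero' (⟨e, he⟩ : rootSpace H α)
    (by simpa using he₀)).1 (finrank_rootSpace_eq_one α hα) ⟨x, hx⟩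
  obtain rfl : c • e = x := congrArg Subtype.val hc
  have key := hf.2 e h (coroot α)
  rw [lie_coe_eq_neg_smul he, lie_coe_eq_neg_smul he, root_apply_coroot hα, apply_coe_coe hf,
    lie_zero] at key
  simp only [map_neg, map_smul, LinearMap.neg_apply, LinearMap.smul_apply, apply_swap hf e,
    ha] at key
  rw [lie_coe_eq_smul hx, map_smul]
  linear_combination (norm := module) (-c / 2) • key

lemma eq_of_apply_eq_smul_lie_neg (hf : f ∈ invAltMaps K L) {α : Weight K H L}
    (hα : α.IsNonZero) {c d : K} (hc : ∀ h : H, ∀ e ∈ rootSpace H α, f h e = c • ⁅(h : L), e⁆)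
    (hd : ∀ h : H, ∀ e ∈ rootSpace H (-α), f h e = d • ⁅(h : L), e⁆) : c = d := by
  obtain ⟨t, e, e', ht, he, he'⟩ := exists_isSl2Triple_of_weight_isNonZero hα
  obtain rfl := ht.h_eq_coroot hα he he'
  have h₁ := hf.2 e (coroot α) e'
  have h₂ := hf.2 e' (coroot α) e
  rw [ht.lie_e_f, hd _ _ he', lie_coe_eq_smul he', lie_coe_eq_neg_smul he, lie_smul, lie_smul,
    ht.lie_e_f, hf.1] at h₁
  rw [← lie_skew e' e, ht.lie_e_f, hc _ _ he, lie_coe_eq_smul he, lie_coe_eq_neg_smul he',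
    lie_smul, lie_smul, ← lie_skew e' e, ht.lie_e_f] at h₂
  simp only [map_neg, map_smul, LinearMap.neg_apply, LinearMap.smul_apply, Pi.neg_apply,
    root_apply_coroot hα, apply_swap hf e' e, hf.1] at h₁ h₂
  refine smul_left_injective K ht.h_ne_zero ?_
  linear_combination (norm := module) (1 / 2 : K) • h₂ - (1 / 2 : K) • h₁

lemma exists_apply_eq_zero_and_apply_ne_zero {α β : Weight K H L} (hα : α.IsNonZero)
    (hβ : β.IsNonZero) (h₁ : β ≠ α) (h₂ : β ≠ -α) : ∃ h : H, α h = 0 ∧ β h ≠ 0 := by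
  by_contra! hcon
  refine (eq_neg_or_eq_of_eq_smul α β hβ (β (coroot α) / 2) (funext fun k => ?_)).elim h₂ h₁
  have h₃ : Weight.toLinear K H L α (k - (α k / 2) • coroot α) = 0 := by
    rw [map_sub, map_smul]
    simp [root_apply_coroot hα]
  have h₄ : Weight.toLinear K H L β (k - (α k / 2) • coroot α) = 0 := hcon _ h₃
  rw [map_sub, map_smul, sub_eq_zero] at h₄
  simp only [Weight.toLinear_apply, smul_eq_mul] at h₄
  rw [h₄, Pi.smul_apply, smul_eq_mul]
  ring

lemma eq_of_apply_lie_eq_smul_lie (hf : f ∈ invAltMaps K L) {α β : H → K} {h : H}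
    (hαh : α h = 0) (hβh : β h ≠ 0) {e e' : L} (he : e ∈ rootSpace H α)
    (he' : e' ∈ rootSpace H β) (hee' : ⁅e, e'⁆ ≠ 0) {c d : K}
    (hc : f h ⁅e, e'⁆ = c • ⁅(h : L), ⁅e, e'⁆⁆) (hd : f h e' = d • ⁅(h : L), e'⁆) : c = d := by
  have h₁ := hf.2 e h e'
  have h₂ := lie_coe_eq_smul (lie_mem_genWeightSpace_of_mem_genWeightSpace he he') h
  rw [lie_coe_eq_neg_smul he, hc, hd, h₂, lie_coe_eq_smul he', lie_smul, lie_smul] at h₁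
  simp only [Pi.add_apply, hαh, zero_smul, neg_zero, map_zero, LinearMap.zero_apply, zero_add,
    smul_smul] at h₁
  exact mul_right_cancel₀ hβh (smul_left_injective K hee' h₁)

lemma eq_of_lie_ne_zero (hf : f ∈ invAltMaps K L) {α β : Weight K H L} (hα : α.IsNonZero)
    (hβ : β.IsNonZero) (h₁ : β ≠ α) (h₂ : β ≠ -α) {e e' : L} (he : e ∈ rootSpace H α)
    (he' : e' ∈ rootSpace H β) (hee' : ⁅e, e'⁆ ≠ 0) {c d : K}
    (hc : ∀ h : H, ∀ e ∈ rootSpace H α, f h e = c • ⁅(h : L), e⁆)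
    (hd : ∀ h : H, ∀ e ∈ rootSpace H β, f h e = d • ⁅(h : L), e⁆) : c = d := by
  have hmem := lie_mem_genWeightSpace_of_mem_genWeightSpace he he'
  let γ : Weight K H L := ⟨α + β, fun h => hee' (by simpa [h] using hmem)⟩
  obtain ⟨h, hαh, hβh⟩ := exists_apply_eq_zero_and_apply_ne_zero hα hβ h₁ h₂
  obtain ⟨h', hβh', hαh'⟩ := exists_apply_eq_zero_and_apply_ne_zero hβ hα h₁.symm
    (fun h => h₂ (by rw [h, neg_neg]))
  have hγ : γ.IsNonZero := fun h₀ => hβh (by simpa [γ, hαh] using congrFun h₀ h)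
  obtain ⟨a, ha⟩ := exists_apply_eq_smul_lie hf γ hγ
  have had : a = d :=
    eq_of_apply_lie_eq_smul_lie hf hαh hβh he he' hee' (ha _ _ hmem) (hd _ _ he')
  have hac : a = c := by
    refine eq_of_apply_lie_eq_smul_lie hf hβh' hαh' he' he (fun h => hee' ?_) ?_ (hc _ _ he)
    · rw [← lie_skew, h, neg_zero]
    · rw [← lie_skew, map_neg, lie_neg, smul_neg, ha _ _ hmem]
  rw [← had, hac]

lemma eq_of_apply_coroot_ne_zero (hf : f ∈ invAltMaps K L) {α β : Weight K H L}
    (hα : α.IsNonZero) (hβ : β.IsNonZero) (hαβ : β (coroot α) ≠ 0) {c d : K}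
    (hc : ∀ h : H, ∀ e ∈ rootSpace H α, f h e = c • ⁅(h : L), e⁆)
    (hd : ∀ h : H, ∀ e ∈ rootSpace H β, f h e = d • ⁅(h : L), e⁆) : c = d := by
  obtain ⟨c', hc'⟩ := exists_apply_eq_smul_lie hf (-α) hα.neg
  have hcc' : c = c' := eq_of_apply_eq_smul_lie_neg hf hα hc hc'
  obtain ⟨x, hx, hx₀⟩ := β.exists_ne_zero
  by_cases h₁ : β = α
  · subst h₁
    have h₃ := (hc (coroot β) x hx).symm.trans (hd (coroot β) x hx)
    rw [lie_coe_eq_smul hx] at h₃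
    exact smul_left_injective K (smul_ne_zero hαβ hx₀) h₃
  by_cases h₂ : β = -α
  · subst h₂
    exact eq_of_apply_eq_smul_lie_neg hf hα hc hd
  obtain ⟨t, e, e', ht, he, he'⟩ := exists_isSl2Triple_of_weight_isNonZero hα
  obtain rfl := ht.h_eq_coroot hα he he'
  by_cases h₃ : ⁅e, x⁆ = 0
  · refine hcc'.trans (eq_of_lie_ne_zero hf hα.neg hβ h₂ (by rwa [neg_neg]) (e := e') he' hx
      (fun h₄ => ?_) hc' hd)
    have h₅ := leibniz_lie e e' x
    rw [h₃, h₄, ht.lie_e_f, lie_zero, lie_zero, add_zero, lie_coe_eq_smul hx] at h₅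
    exact smul_ne_zero hαβ hx₀ h₅.symm
  · exact eq_of_lie_ne_zero hf hα hβ h₁ h₂ he hx h₃ hc hd

lemma apply_coroot_eq_zero (hf : f ∈ invAltMaps K L) {α : Weight K H L}
    (hα : α.IsNonZero) (hc : ∀ h : H, ∀ e ∈ rootSpace H α, f h e = 0) : f (coroot α) = 0 := by
  rw [← LinearMap.ker_eq_top, ← top_le_iff, ← LieSubmodule.top_toSubmodule (R := K) (L := H),
    ← cartan_sup_iSup_rootSpace_eq_top (K := K) (L := L) (H := H)]
  simp only [LieSubmodule.sup_toSubmodule, LieSubmodule.iSup_toSubmodule, sup_le_iff, iSup_le_iff]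
  refine ⟨fun x hx => apply_coe_coe hf (coroot α) ⟨x, hx⟩, fun β hβ x hx => ?_⟩
  have hx : x ∈ rootSpace H β := hx
  obtain ⟨d, hd⟩ := exists_apply_eq_smul_lie hf β hβ
  rw [LinearMap.mem_ker, hd _ _ hx, lie_coe_eq_smul hx]
  by_cases hβα : β (coroot α) = 0
  · simp [hβα]
  · rw [← eq_of_apply_coroot_ne_zero (c := 0) hf hα hβ hβα (by simpa using hc) hd, zero_smul]

end IsKilling

section IsSimple

variable {K L : Type*} [Field K] [CharZero K] [LieRing L] [LieAlgebra K L]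
  [FiniteDimensional K L] [LieAlgebra.IsSimple K L]

lemma exists_weight_isNonZero (H : LieSubalgebra K L) [H.IsCartanSubalgebra]
    [IsTriangularizable K H L] : ∃ α : Weight K H L, α.IsNonZero := by
  by_contra hcon
  rw [not_exists] at hcon
  have h := cartan_sup_iSup_rootSpace_eq_top (K := K) (L := L) (H := H)
  simp only [hcon, not_false_eq_true, iSup_neg, iSup_bot, sup_bot_eq] at h
  have hH (x : L) : x ∈ H := by
    rw [← LieSubalgebra.mem_toLieSubmodule, h]
    exact LieSubmodule.mem_top x
  exact IsSimple.non_abelian (R := K) (L := L) ⟨fun x y => lie_coe_coe (K := K) ⟨x, hH x⟩ ⟨y, hH y⟩⟩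

lemma eq_span_bracketBilin (H : LieSubalgebra K L) [H.IsCartanSubalgebra]
    [IsTriangularizable K H L] : invAltMaps K L = Submodule.span K {bracketBilin K L} := by
  refine le_antisymm (fun f hf => ?_) ?_
  · obtain ⟨α, hα⟩ := exists_weight_isNonZero H
    obtain ⟨c, hc⟩ := exists_apply_eq_smul_lie hf α hα
    have hg : f - c • bracketBilin K L ∈ invAltMaps K L :=
      sub_mem hf (Submodule.smul_mem _ c (bracketBilin_mem_invAltMaps K L))
    have hker : (coroot α : L) ∈ leftKer hg :=
      apply_coroot_eq_zero hg hα fun h e he => sub_eq_zero.2 (hc h e he)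
    obtain hI | hI := IsSimple.eq_bot_or_eq_top (leftKer hg)
    · rw [hI, LieSubmodule.mem_bot, ZeroMemClass.coe_eq_zero, coroot_eq_zero_iff] at hker
      exact absurd hker hα
    · refine Submodule.mem_span_singleton.2 ⟨c, (sub_eq_zero.1 (LinearMap.ext fun x => ?_)).symm⟩
      exact (mem_leftKer hg).1 (hI ▸ LieSubmodule.mem_top x)
  · rw [Submodule.span_singleton_le_iff_mem]
    exact bracketBilin_mem_invAltMaps K L

omit [CharZero K] [FiniteDimensional K L] in
lemma bracketBilin_ne_zero : bracketBilin K L ≠ 0 := fun h =>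
  IsSimple.non_abelian (R := K) (L := L) ⟨fun x y => LinearMap.congr_fun₂ h x y⟩

end IsSimple

end invAltMaps

/-- For a finite-dimensional simple Lie algebra `L` over `ℂ`, the space of alternating
invariant bilinear maps `L × L → L` is one-dimensional, spanned by the Lie bracket. -/
theorem finrank_invAltMaps_eq_one_and_span_bracket
    (L : Type*) [LieRing L] [LieAlgebra ℂ L] [FiniteDimensional ℂ L]
    [LieAlgebra.IsSimple ℂ L] :
    Module.finrank ℂ (invAltMaps ℂ L) = 1 ∧
      invAltMaps ℂ L = Submodule.span ℂ {bracketBilin ℂ L} := by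
  obtain ⟨x, hx⟩ := exists_isCartanSubalgebra_engel ℂ L
  have hspan := invAltMaps.eq_span_bracketBilin (LieSubalgebra.engel ℂ x)
  exact ⟨by rw [hspan, finrank_span_singleton invAltMaps.bracketBilin_ne_zero], hspan⟩
end

section
/- Let 𝔤 be a finite-dimensional simple Lie algebra over ℂ, R a nontrivial commutative ring equipped with a ℂ-algebra structure, and let 𝔞 be a Lie algebra over R whose underlying R-module is 𝔤_R × 𝔤_R and whose bracket satisfies [(x,0),(y,0)] = ([x,y],0) and [(x,0),(0,y)] = (0,[x,y]) for all x, y ∈ 𝔤_R. Then there exist unique α, β ∈ R such that [(0,x),(0,y)] = (α[x,y], β[x,y]) for all x, y ∈ 𝔤_R. -/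
open TensorProduct

namespace LieAlgebra

open LieModule LieAlgebra.IsKilling Module

/-- An alternating bilinear map on a Lie algebra which is equivariant for the adjoint action. -/
structure IsInvariantAlternating {K L : Type*} [CommRing K] [LieRing L] [LieAlgebra K L]
    (φ : L →ₗ[K] L →ₗ[K] L) : Prop where
  self : ∀ x, φ x x = 0
  lie : ∀ z x y : L, ⁅z, φ x y⁆ = φ ⁅z, x⁆ y + φ x ⁅z, y⁆

namespace IsInvariantAlternating

section CommRing

variable {K L : Type*} [CommRing K] [LieRing L] [LieAlgebra K L] {φ : L →ₗ[K] L →ₗ[K] L}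

lemma skew (hφ : IsInvariantAlternating φ) (x y : L) : φ x y = -φ y x := by
  have h := hφ.self (x + y)
  simp only [map_add, LinearMap.add_apply, hφ.self, zero_add, add_zero] at h
  exact eq_neg_of_add_eq_zero_right h

lemma sub_smul_lie (hφ : IsInvariantAlternating φ) (c : K) :
    IsInvariantAlternating (φ - c • (ad K L : L →ₗ[K] End K L)) where
  self x := by simp [hφ.self]
  lie z x y := by
    simp only [LinearMap.sub_apply, LinearMap.smul_apply, LieHom.coe_toLinearMap, ad_apply,
      lie_sub, lie_smul, hφ.lie, leibniz_lie z x y, smul_add]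
    abel

/-- An invariant alternating map on a simple Lie algebra with nontrivial kernel vanishes. -/
lemma eq_zero_of_apply_eq_zero [IsSimple K L] (hφ : IsInvariantAlternating φ) {x : L}
    (hx₀ : x ≠ 0) (hx : φ x = 0) : φ = 0 := by
  let I : LieIdeal K L :=
    { LinearMap.ker φ with
      lie_mem := by
        intro z y (hy : φ y = 0)
        change φ ⁅z, y⁆ = 0
        ext w
        simpa [hy] using (hφ.lie z y w).symm }
  have hI : I = ⊤ := (IsSimpleOrder.eq_bot_or_eq_top I).resolve_left fun h ↦
    hx₀ ((LieSubmodule.mem_bot x).mp (h ▸ (show x ∈ I from hx)))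
  ext1 y
  exact show y ∈ I from hI ▸ LieSubmodule.mem_top y

end CommRing

variable {K L : Type*} [Field K] [CharZero K] [LieRing L] [LieAlgebra K L]
  [FiniteDimensional K L] [IsKilling K L] {H : LieSubalgebra K L} [H.IsCartanSubalgebra]
  [IsTriangularizable K H L] {φ : L →ₗ[K] L →ₗ[K] L}

lemma lie_cartan {χ : H → K} {v : L} (hv : v ∈ rootSpace H χ) (h : H) :
    ⁅(h : L), v⁆ = χ h • v :=
  lie_eq_smul_of_mem_rootSpace hv h

lemma lie_cartan' {χ : H → K} {v : L} (hv : v ∈ rootSpace H χ) (h : H) :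
    ⁅v, (h : L)⁆ = -(χ h • v) := by
  rw [← lie_skew, lie_cartan hv]

lemma apply_mem_rootSpace (hφ : IsInvariantAlternating φ) {χ₁ χ₂ : H → K} {x y : L}
    (hx : x ∈ rootSpace H χ₁) (hy : y ∈ rootSpace H χ₂) : φ x y ∈ rootSpace H (χ₁ + χ₂) := by
  refine weightSpace_le_genWeightSpace L _ ((mem_weightSpace _ _).mpr fun h ↦ ?_)
  change ⁅(h : L), φ x y⁆ = _
  simp [hφ.lie, lie_cartan hx, lie_cartan hy, add_smul]

lemma exists_eq_smul_of_mem_rootSpace {χ : H → K} (hχ : χ ≠ 0) {v w : L} (hv₀ : v ≠ 0)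
    (hv : v ∈ rootSpace H χ) (hw : w ∈ rootSpace H χ) : ∃ c : K, w = c • v := by
  let α : Weight K H L := ⟨χ, fun h ↦ hv₀ (by rwa [rootSpace, h, LieSubmodule.mem_bot] at hv)⟩
  have h1 : finrank K (rootSpace H χ) = 1 := finrank_rootSpace_eq_one α hχ
  obtain ⟨c, hc⟩ := (finrank_eq_one_iff_of_nonzero' (⟨v, hv⟩ : rootSpace H χ)
    (by simpa using hv₀)).mp h1 ⟨w, hw⟩
  exact ⟨c, (congrArg Subtype.val hc).symm⟩

lemma exists_apply_eq_smul (hφ : IsInvariantAlternating φ) {χ : H → K} (hχ : χ ≠ 0) {v : L}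
    (hv : v ∈ rootSpace H χ) (h : H) : ∃ c : K, φ h v = c • v := by
  rcases eq_or_ne v 0 with rfl | hv₀
  · exact ⟨0, by simp⟩
  · refine exists_eq_smul_of_mem_rootSpace hχ hv₀ hv ?_
    simpa using hφ.apply_mem_rootSpace (toLieSubmodule_le_rootSpace_zero K L H h.property) hv

lemma exists_lie_eq_coroot {α : Weight K H L} (hα : α.IsNonZero) :
    ∃ e f : L, e ≠ 0 ∧ e ∈ rootSpace H α ∧ f ∈ rootSpace H (-α) ∧ ⁅e, f⁆ = coroot α := by
  obtain ⟨h, e, f, ht, he, hf⟩ := exists_isSl2Triple_of_weight_isNonZero hα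
  exact ⟨e, f, ht.e_ne_zero, he, hf, ht.lie_e_f.trans (ht.h_eq_coroot hα he hf)⟩

lemma exists_apply_coroot_eq_smul (hφ : IsInvariantAlternating φ) {α : Weight K H L}
    (hα : α.IsNonZero) (h : H) : ∃ c : K, φ (coroot α) h = c • (coroot α : L) := by
  obtain ⟨e, f, -, he, hf, hef⟩ := exists_lie_eq_coroot hα
  set k : H := h - (α h / 2) • coroot α with hk
  have hαk : α k = 0 := by
    have h2 := root_apply_coroot hα
    rw [← Weight.toLinear_apply] at h2 ⊢
    rw [hk, map_sub, map_smul, h2, Weight.toLinear_apply, smul_eq_mul]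
    ring
  have hhk : φ (coroot α) h = φ (coroot α) k := by
    simp [hk, hφ.self]
  have hα' : -(α : H → K) ≠ 0 := by simpa using hα
  obtain ⟨c, hc⟩ := hφ.exists_apply_eq_smul hα' hf k
  have h1 := hφ.lie e f k
  rw [lie_cartan' he, hαk, hef, hφ.skew f k, hc] at h1
  refine ⟨-c, ?_⟩
  rw [hhk]
  simpa [hef] using h1.symm

/-- Invariant alternating maps vanish on a Cartan subalgebra. -/
lemma apply_cartan_cartan (hφ : IsInvariantAlternating φ) (h k : H) : φ h k = 0 := by
  have key (α β : Weight K H L) (hα : α.IsNonZero) (hβ : β.IsNonZero) :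
      φ (coroot α) (coroot β) = 0 := by
    obtain ⟨a, ha⟩ := hφ.exists_apply_coroot_eq_smul hα (coroot β)
    obtain ⟨b, hb⟩ := hφ.exists_apply_coroot_eq_smul hβ (coroot α)
    rcases eq_or_ne a 0 with rfl | ha₀
    · simpa using ha
    · have h1 : (coroot α : L) = (-(a⁻¹ * b)) • (coroot β : L) := by
        rw [hφ.skew, hb] at ha
        rw [neg_smul, mul_smul, ← smul_neg, ha, inv_smul_smul₀ ha₀]
      rw [h1]
      simp [hφ.self]
  have hspan := RootPairing.IsRootSystem.span_coroot_eq_top (P := rootSystem H)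
  have hB : φ.domRestrict₁₂ H.toSubmodule H.toSubmodule = 0 := by
    refine LinearMap.ext_on hspan ?_
    rintro - ⟨α, rfl⟩
    refine LinearMap.ext_on hspan ?_
    rintro - ⟨β, rfl⟩
    exact key α β (LieSubalgebra.isNonZero_coe_root α) (LieSubalgebra.isNonZero_coe_root β)
  exact LinearMap.congr_fun (LinearMap.congr_fun hB h) k

/-- On each root space, an invariant alternating map is proportional to the bracket with the
Cartan subalgebra. -/
lemma exists_apply_cartan_eq_smul (hφ : IsInvariantAlternating φ) {χ : H → K} (hχ : χ ≠ 0) {v : L}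
    (hv : v ∈ rootSpace H χ) : ∃ c : K, ∀ h : H, φ h v = (c * χ h) • v := by
  obtain ⟨h₀, hh₀⟩ := Function.ne_iff.mp hχ
  simp only [Pi.zero_apply] at hh₀
  obtain ⟨a, ha⟩ := hφ.exists_apply_eq_smul hχ hv h₀
  refine ⟨a / χ h₀, fun h ↦ ?_⟩
  have h1 := hφ.lie v h₀ h
  rw [hφ.apply_cartan_cartan, lie_zero, lie_cartan' hv, lie_cartan' hv, map_neg, map_smul, map_neg,
    map_smul, LinearMap.neg_apply, LinearMap.smul_apply, hφ.skew v h, ha, smul_neg, neg_neg,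
    eq_comm, add_neg_eq_zero] at h1
  rw [← inv_smul_smul₀ hh₀ (φ h v), h1, smul_smul, smul_smul]
  congr 1
  ring

/-- If two roots are not proportional, some element is killed by one but not by the other. -/
lemma exists_apply_eq_zero_of_ne {α β : Weight K H L} (hα : α.IsNonZero) (hβ : β.IsNonZero)
    (h1 : β ≠ α) (h2 : β ≠ -α) : ∃ h : H, β h = 0 ∧ α h ≠ 0 := by
  by_contra! hc
  have key (h : H) : α h = (α (coroot β) / 2) * β h := by
    have hβ2 := root_apply_coroot hβ
    have := hc (h - (β h / 2) • coroot β)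
    simp only [← Weight.toLinear_apply] at hβ2 this ⊢
    simp only [map_sub, map_smul, hβ2, smul_eq_mul] at this
    have := this (by ring)
    linear_combination this
  rcases eq_neg_or_eq_of_eq_smul β α hα (α (coroot β) / 2) (funext key) with h | h
  · exact h2 (by rw [h, neg_neg])
  · exact h1 h.symm

lemma eq_zero_of_apply_root (hφ : IsInvariantAlternating φ) {α : Weight K H L} (hα : α.IsNonZero)
    {e : L} (he₀ : e ≠ 0) (he : e ∈ rootSpace H α) (hH : ∀ h : H, φ h e = 0) : φ e = 0 := by
  suffices ∀ β : Weight K H L, ∀ v ∈ rootSpace H β, φ e v = 0 by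
    have hle : (⨆ β : Weight K H L, genWeightSpace L β).toSubmodule ≤ LinearMap.ker (φ e) := by
      rw [LieSubmodule.iSup_toSubmodule]
      exact iSup_le fun β v hv ↦ this β v hv
    rw [iSup_genWeightSpace_eq_top'] at hle
    ext v
    exact hle (LieSubmodule.mem_top v)
  intro β v hv
  have key (h : H) : β h • φ v e = φ h ⁅v, e⁆ := by
    have h1 := hφ.lie v h e
    rw [hH, lie_zero, lie_cartan' hv, map_neg, map_smul, LinearMap.neg_apply,
      LinearMap.smul_apply, eq_comm, neg_add_eq_zero] at h1
    exact h1
  rw [hφ.skew, neg_eq_zero]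
  by_cases hβ : β.IsZero
  · have hvH : v ∈ H := by
      rw [show (β : H → K) = 0 from hβ] at hv
      rw [← zeroRootSubalgebra_eq_of_is_cartan K L H]
      exact hv
    exact hH ⟨v, hvH⟩
  rcases eq_or_ne β α with rfl | h1
  · obtain ⟨c, rfl⟩ := exists_eq_smul_of_mem_rootSpace hβ he₀ he hv
    simp [hφ.self]
  obtain ⟨h₀, hh₀⟩ := Function.ne_iff.mp hβ
  simp only [Pi.zero_apply] at hh₀
  suffices φ h₀ ⁅v, e⁆ = 0 from (smul_eq_zero_iff_right hh₀).mp ((key h₀).trans this)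
  have hve : ⁅v, e⁆ ∈ rootSpace H (β + α : H → K) :=
    lie_mem_genWeightSpace_of_mem_genWeightSpace hv he
  rcases eq_or_ne β (-α) with rfl | h2
  · have hvH : ⁅v, e⁆ ∈ H := by
      rw [Weight.coe_neg, neg_add_cancel] at hve
      rw [← zeroRootSubalgebra_eq_of_is_cartan K L H]
      exact hve
    exact hφ.apply_cartan_cartan h₀ ⟨_, hvH⟩
  obtain ⟨k, hk1, hk2⟩ := exists_apply_eq_zero_of_ne hα hβ h1 h2
  have hne : (β + α : H → K) ≠ 0 := fun h ↦ hk2 (by simpa [hk1] using congrFun h k)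
  obtain ⟨c, hc⟩ := hφ.exists_apply_cartan_eq_smul hne hve
  have h3 := key k
  rw [hk1, zero_smul, hc, eq_comm, smul_eq_zero] at h3
  rcases h3 with h3 | h3
  · have : c = 0 := by simpa [hk1, hk2] using h3
    simp [hc, this]
  · simp [h3]

end IsInvariantAlternating

/-- Every invariant alternating bilinear map on a finite-dimensional simple Lie algebra over an
algebraically closed field of characteristic zero is a multiple of the bracket. -/
theorem IsInvariantAlternating.exists_eq_smul_lie {K L : Type*} [Field K] [CharZero K]
    [IsAlgClosed K] [LieRing L] [LieAlgebra K L] [FiniteDimensional K L] [IsSimple K L]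
    {φ : L →ₗ[K] L →ₗ[K] L} (hφ : IsInvariantAlternating φ) :
    ∃ c : K, ∀ x y, φ x y = c • ⁅x, y⁆ := by
  obtain ⟨x, hx⟩ := exists_isCartanSubalgebra_engel K L
  let H := LieSubalgebra.engel K x
  obtain ⟨α, hα⟩ : ∃ α : Weight K H L, α.IsNonZero := by
    by_contra! hc
    have hH : H = ⊤ := by
      rw [eq_top_iff]
      intro y _
      have hy : y ∈ (⨆ β : Weight K H L, genWeightSpace L β) := by
        rw [iSup_genWeightSpace_eq_top']
        exact LieSubmodule.mem_top y
      rw [← zeroRootSubalgebra_eq_of_is_cartan K L H]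
      refine (iSup_le fun β ↦ ?_ : _ ≤ rootSpace H (0 : H → K)) hy
      rw [show (β : H → K) = 0 from hc β]
    refine IsSimple.non_abelian K (L := L) ⟨fun y z ↦ ?_⟩
    have := LieModule.IsTrivial.trivial (⟨y, hH ▸ LieSubalgebra.mem_top y⟩ : H)
      (⟨z, hH ▸ LieSubalgebra.mem_top z⟩ : H)
    exact congrArg Subtype.val this
  obtain ⟨e, he, he₀⟩ := α.exists_ne_zero
  obtain ⟨c, hc⟩ := hφ.exists_apply_cartan_eq_smul hα he
  have hψ := hφ.sub_smul_lie c
  have h0 := hψ.eq_zero_of_apply_eq_zero he₀ <| hψ.eq_zero_of_apply_root hα he₀ he fun h ↦ by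
    simp [hc, lie_cartan he, mul_smul]
  refine ⟨c, fun y z ↦ ?_⟩
  simpa [sub_eq_zero] using LinearMap.congr_fun (LinearMap.congr_fun h0 y) z

section BaseChange

variable {K L R : Type*} [Field K] [LieRing L] [LieAlgebra K L] [CommRing R] [Algebra K R]

/-- The contraction `R ⊗[K] L → L` along a linear functional on `R`. -/
noncomputable def contractLeft (L : Type*) [AddCommGroup L] [Module K L] (f : R →ₗ[K] K) :
    R ⊗[K] L →ₗ[K] L :=
  TensorProduct.lid K L ∘ₗ f.rTensor L

/-- The contraction `R ⊗[K] L → R` along a linear functional on `L`. -/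
noncomputable def contractRight (R : Type*) [CommRing R] [Algebra K R] (ξ : L →ₗ[K] K) :
    R ⊗[K] L →ₗ[K] R :=
  TensorProduct.rid K R ∘ₗ ξ.lTensor R

@[simp] lemma contractLeft_tmul (f : R →ₗ[K] K) (r : R) (x : L) :
    contractLeft L f (r ⊗ₜ[K] x) = f r • x := by
  simp [contractLeft]

@[simp] lemma contractRight_tmul (ξ : L →ₗ[K] K) (r : R) (x : L) :
    contractRight R ξ (r ⊗ₜ[K] x) = ξ x • r := by
  simp [contractRight]

lemma apply_contractRight (f : R →ₗ[K] K) (ξ : L →ₗ[K] K) (z : R ⊗[K] L) :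
    f (contractRight R ξ z) = ξ (contractLeft L f z) := by
  induction z with
  | zero => simp
  | tmul r x => simp [mul_comm]
  | add z w hz hw => simp [hz, hw]

lemma contractLeft_lie (f : R →ₗ[K] K) (x : L) (z : R ⊗[K] L) :
    contractLeft L f ⁅(1 : R) ⊗ₜ[K] x, z⁆ = ⁅x, contractLeft L f z⁆ := by
  induction z with
  | zero => simp
  | tmul r y => simp [ExtendScalars.bracket_tmul]
  | add z w hz hw => simp [hz, hw]

lemma contractLeft_smul_one_tmul (f : R →ₗ[K] K) (a : R) (x : L) :
    contractLeft L f (a • ((1 : R) ⊗ₜ[K] x)) = f a • x := by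
  simp [TensorProduct.smul_tmul']

lemma eq_of_contractLeft_eq [FiniteDimensional K L] {z w : R ⊗[K] L}
    (h : ∀ f : R →ₗ[K] K, contractLeft L f z = contractLeft L f w) : z = w := by
  let b := finBasis K L
  have key (f : R →ₗ[K] K) (i) (z : R ⊗[K] L) :
      f ((b.baseChange R).repr z i) = b.repr (contractLeft L f z) i := by
    induction z with
    | zero => simp
    | tmul r x => simp [mul_comm]
    | add z w hz hw => simp [hz, hw]
  refine (b.baseChange R).ext_elem fun i ↦ ?_
  rw [← sub_eq_zero, ← Module.forall_dual_apply_eq_zero_iff K]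
  intro f
  rw [map_sub, key, key, h, sub_self]

lemma exists_dual_apply_lie_eq_one [IsSimple K L] :
    ∃ (x y : L) (ξ : L →ₗ[K] K), ξ ⁅x, y⁆ = 1 := by
  obtain ⟨x, y, hxy⟩ : ∃ x y : L, ⁅x, y⁆ ≠ 0 := by
    by_contra! h
    exact IsSimple.non_abelian K (L := L) ⟨h⟩
  obtain ⟨ξ, hξ⟩ : ∃ ξ : Dual K L, ξ ⁅x, y⁆ ≠ 0 := by
    by_contra! h
    exact hxy ((Module.forall_dual_apply_eq_zero_iff K _).mp h)
  exact ⟨x, y, (ξ ⁅x, y⁆)⁻¹ • ξ, by simp [hξ]⟩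

lemma eq_of_forall_smul_lie_eq [IsSimple K L] {a b : R}
    (h : ∀ x y : R ⊗[K] L, a • ⁅x, y⁆ = b • ⁅x, y⁆) : a = b := by
  obtain ⟨x, y, ξ, hξ⟩ := exists_dual_apply_lie_eq_one (K := K) (L := L)
  simpa [ExtendScalars.bracket_tmul, TensorProduct.smul_tmul', hξ] using
    congrArg (contractRight R ξ) (h (1 ⊗ₜ x) (1 ⊗ₜ y))

/-- The contraction of a bilinear map on `R ⊗[K] L` to a bilinear map on `L`. -/
noncomputable def contractBilin (Φ : R ⊗[K] L →ₗ[R] R ⊗[K] L →ₗ[R] R ⊗[K] L) (f : R →ₗ[K] K) :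
    L →ₗ[K] L →ₗ[K] L :=
  LinearMap.mk₂ K (fun x y ↦ contractLeft L f (Φ (1 ⊗ₜ x) (1 ⊗ₜ y)))
    (by simp [TensorProduct.tmul_add]) (by simp [LinearMap.map_smul_of_tower])
    (by simp [TensorProduct.tmul_add]) (by simp [LinearMap.map_smul_of_tower])

lemma IsInvariantAlternating.contractBilin {Φ : R ⊗[K] L →ₗ[R] R ⊗[K] L →ₗ[R] R ⊗[K] L}
    (hΦ : IsInvariantAlternating Φ) (f : R →ₗ[K] K) :
    IsInvariantAlternating (contractBilin Φ f) where
  self x := by simp [LieAlgebra.contractBilin, hΦ.self]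
  lie z x y := by
    simp [LieAlgebra.contractBilin, ← contractLeft_lie, hΦ.lie, ExtendScalars.bracket_tmul]

/-- Every invariant alternating bilinear map on the base change of a finite-dimensional simple Lie
algebra over an algebraically closed field of characteristic zero is a multiple of the bracket. -/
theorem IsInvariantAlternating.exists_eq_smul_lie_baseChange [CharZero K] [IsAlgClosed K]
    [FiniteDimensional K L] [IsSimple K L] {Φ : R ⊗[K] L →ₗ[R] R ⊗[K] L →ₗ[R] R ⊗[K] L}
    (hΦ : IsInvariantAlternating Φ) : ∃ a : R, ∀ x y, Φ x y = a • ⁅x, y⁆ := by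
  obtain ⟨x₀, y₀, ξ, hξ⟩ := exists_dual_apply_lie_eq_one (K := K) (L := L)
  set a : R := contractRight R ξ (Φ (1 ⊗ₜ x₀) (1 ⊗ₜ y₀)) with ha
  have key (x y : L) : Φ (1 ⊗ₜ x) (1 ⊗ₜ y) = a • ⁅(1 : R) ⊗ₜ[K] x, (1 : R) ⊗ₜ[K] y⁆ := by
    refine eq_of_contractLeft_eq fun f ↦ ?_
    obtain ⟨c, hc⟩ := (hΦ.contractBilin f).exists_eq_smul_lie
    simp only [LieAlgebra.contractBilin, LinearMap.mk₂_apply] at hc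
    rw [hc, ExtendScalars.bracket_tmul, mul_one, contractLeft_smul_one_tmul, ha,
      apply_contractRight, hc, map_smul, hξ, smul_eq_mul, mul_one]
  let b := (finBasis K L).baseChange R
  have h : Φ = a • (ad R (R ⊗[K] L) : R ⊗[K] L →ₗ[R] End R (R ⊗[K] L)) := by
    refine b.ext fun i ↦ b.ext fun j ↦ ?_
    simpa [b] using key (finBasis K L i) (finBasis K L j)
  exact ⟨a, fun x y ↦ LinearMap.congr_fun (LinearMap.congr_fun h x) y⟩

end BaseChange

end LieAlgebra

/-- Let `L` be a finite-dimensional simple Lie algebra over `ℂ`, `R` a nontrivial commutative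
`ℂ`-algebra, and `A` a Lie algebra over `R` whose underlying `R`-module is
`(R ⊗[ℂ] L) × (R ⊗[ℂ] L)` (via the `R`-linear equivalence `e`), such that
`[(x,0),(y,0)] = ([x,y],0)` and `[(x,0),(0,y)] = (0,[x,y])`.  Then there exist unique
`α, β ∈ R` with `[(0,x),(0,y)] = (α • [x,y], β • [x,y])` for all `x, y`. -/
theorem exists_unique_structure_scalars
    (L : Type*) [LieRing L] [LieAlgebra ℂ L] [FiniteDimensional ℂ L]
    [LieAlgebra.IsSimple ℂ L]
    (R : Type*) [CommRing R] [Nontrivial R] [Algebra ℂ R]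
    (A : Type*) [LieRing A] [LieAlgebra R A]
    (e : ((R ⊗[ℂ] L) × (R ⊗[ℂ] L)) ≃ₗ[R] A)
    (h1 : ∀ x y : R ⊗[ℂ] L, ⁅e (x, 0), e (y, 0)⁆ = e (⁅x, y⁆, 0))
    (h2 : ∀ x y : R ⊗[ℂ] L, ⁅e (x, 0), e (0, y)⁆ = e (0, ⁅x, y⁆)) :
    ∃! p : R × R, ∀ x y : R ⊗[ℂ] L,
      ⁅e (0, x), e (0, y)⁆ = e (p.1 • ⁅x, y⁆, p.2 • ⁅x, y⁆) := by
  let i : R ⊗[ℂ] L →ₗ[R] A := e.toLinearMap ∘ₗ LinearMap.inr R _ _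
  let B : R ⊗[ℂ] L →ₗ[R] R ⊗[ℂ] L →ₗ[R] A :=
    (LieAlgebra.ad R A : A →ₗ[R] Module.End R A).compl₁₂ i i
  have hB (x y) : B x y = ⁅e (0, x), e (0, y)⁆ := rfl
  have h3 (z : R ⊗[ℂ] L) (p : (R ⊗[ℂ] L) × (R ⊗[ℂ] L)) :
      ⁅e (z, 0), e p⁆ = e (⁅z, p.1⁆, ⁅z, p.2⁆) := by
    have hp : p = (p.1, 0) + (0, p.2) := by simp
    rw [hp, map_add, lie_add, h1, h2, ← map_add]
    simp
  have hlie (z x y : R ⊗[ℂ] L) :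
      (⁅z, (e.symm (B x y)).1⁆, ⁅z, (e.symm (B x y)).2⁆) =
        e.symm (B ⁅z, x⁆ y) + e.symm (B x ⁅z, y⁆) := by
    apply e.injective
    rw [← h3, e.apply_symm_apply, map_add, e.apply_symm_apply, e.apply_symm_apply, hB, hB, hB,
      leibniz_lie, h2, h2]
  have hΦ₁ : LieAlgebra.IsInvariantAlternating
      (B.compr₂ (LinearMap.fst R _ _ ∘ₗ e.symm.toLinearMap)) :=
    ⟨fun x ↦ by simp [hB], fun z x y ↦ congrArg Prod.fst (hlie z x y)⟩
  have hΦ₂ : LieAlgebra.IsInvariantAlternating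
      (B.compr₂ (LinearMap.snd R _ _ ∘ₗ e.symm.toLinearMap)) :=
    ⟨fun x ↦ by simp [hB], fun z x y ↦ congrArg Prod.snd (hlie z x y)⟩
  obtain ⟨a, ha⟩ := hΦ₁.exists_eq_smul_lie_baseChange
  obtain ⟨b, hb⟩ := hΦ₂.exists_eq_smul_lie_baseChange
  have hab (x y : R ⊗[ℂ] L) : ⁅e (0, x), e (0, y)⁆ = e (a • ⁅x, y⁆, b • ⁅x, y⁆) := by
    rw [← hB, ← e.symm_apply_eq]
    exact Prod.ext (ha x y) (hb x y)
  refine ⟨(a, b), hab, ?_⟩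
  rintro ⟨a', b'⟩ h
  have h4 (x y : R ⊗[ℂ] L) := Prod.ext_iff.mp (e.injective ((h x y).symm.trans (hab x y)))
  exact Prod.ext (LieAlgebra.eq_of_forall_smul_lie_eq fun x y ↦ (h4 x y).1)
    (LieAlgebra.eq_of_forall_smul_lie_eq fun x y ↦ (h4 x y).2)
end

section
/- Let 𝔤 be a finite-dimensional simple Lie algebra over ℂ and R an integral domain equipped with a ℂ-algebra structure. Let 𝔞 be a Lie algebra over R whose underlying R-module is 𝔤_R × 𝔤_R and whose bracket satisfies [(x,0),(y,0)] = ([x,y],0) and [(x,0),(0,y)] = (0,[x,y]) for all x, y ∈ 𝔤_R. Then there exists a nonzero commutative R-algebra S of finite type such that the base change S ⊗_R 𝔞 is isomorphic as a Lie algebra over S either to the direct product Lie algebra 𝔤_S × 𝔤_S or to the Takiff algebra T(𝔤)_S. -/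
open TensorProduct

/-- The Takiff bracket on `M × M`: `[(x,x'),(y,y')] = ([x,y], [x,y'] + [x',y])`,
i.e. the bracket of `𝔤 ⊗ S[ε]/(ε²)`. -/
def takiffBracket {M : Type*} [LieRing M] (u v : M × M) : M × M :=
  (⁅u.1, v.1⁆, ⁅u.1, v.2⁆ + ⁅u.2, v.1⁆)

open LieAlgebra LieModule in
/-- A simple complex Lie algebra has an extremal `𝔰𝔩₂`-triple: `e` spans a highest root space, `f` the
opposite one, and `f` generates the adjoint module under the centralizer of `e`. -/
theorem LieAlgebra.IsSimple.exists_extremal_isSl2Triple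
    (L : Type*) [LieRing L] [LieAlgebra ℂ L] [FiniteDimensional ℂ L] [LieAlgebra.IsSimple ℂ L] :
    ∃ (H : LieSubalgebra ℂ L) (α : H → ℂ) (h : H) (e f : L), IsSl2Triple (h : L) e f ∧
      (∀ t : H, ⁅(t : L), (h : L)⁆ = 0) ∧ (∀ t : H, ⁅(t : L), f⁆ = α t • f) ∧
      (∀ w : L, (∀ t : H, ⁅(t : L), w⁆ = α t • w) → ∃ c : ℂ, w = c • f) ∧
      ∀ M : Submodule ℂ L, f ∈ M → (∀ x : L, ⁅x, e⁆ = 0 → ∀ m ∈ M, ⁅x, m⁆ ∈ M) → M = ⊤ := by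
  obtain ⟨H, hH⟩ : ∃ H : LieSubalgebra ℂ L, H.IsCartanSubalgebra :=
    (exists_isCartanSubalgebra_engel ℂ L).imp' _ fun _ h => h
  have hzero : ∀ x : L, x ∈ genWeightSpace L (0 : H → ℂ) → x ∈ H := fun x hx => by
    have h0 := rootSpace_zero_eq ℂ L H
    exact (SetLike.ext_iff.mp h0 x).mp hx
  have htop := iSup_genWeightSpace_eq_top' ℂ H L
  have hne : ∃ χ : Weight ℂ H L, χ.IsNonZero := by
    by_contra! hcon
    have hHtop : ∀ x : L, x ∈ H := by
      intro x
      have hx : x ∈ ⨆ χ : Weight ℂ H L, genWeightSpace L χ := by rw [htop]; trivial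
      have hle : ⨆ χ : Weight ℂ H L, genWeightSpace L χ ≤ H.toLieSubmodule := by
        refine iSup_le fun χ => ?_
        have h0 : (χ : H → ℂ) = 0 := by simpa using hcon χ
        rw [h0]
        exact fun y hy => hzero y hy
      exact hle hx
    apply IsSimple.non_abelian ℂ (L := L)
    refine ⟨fun x y => ?_⟩
    have := trivial_lie_zero H H ⟨x, hHtop x⟩ ⟨y, hHtop y⟩
    simpa using congrArg (Subtype.val) this
  obtain ⟨h₀, hh₀⟩ := Module.Dual.exists_forall_ne_zero_of_forall_exists
    (fun χ : {χ : Weight ℂ H L // χ.IsNonZero} =>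
      Complex.reLm.comp ((Weight.toLinear ℂ H L χ.1).restrictScalars ℝ)) (by
    rintro ⟨χ, hχ⟩
    obtain ⟨t, ht⟩ : ∃ t, χ t ≠ 0 := by
      by_contra! hcon
      exact hχ (funext hcon)
    by_cases hre : (χ t).re = 0
    · refine ⟨Complex.I • t, ?_⟩
      have him : (χ t).im ≠ 0 := fun him => ht (Complex.ext hre him)
      have : Weight.toLinear ℂ H L χ (Complex.I • t) = Complex.I * χ t := by
        rw [map_smul]; rfl
      simpa [this] using him
    · exact ⟨t, by simpa using hre⟩)
  let key : Weight ℂ H L → ℝ := fun χ => (χ h₀).re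
  have hkey : ∀ χ : Weight ℂ H L, χ.IsNonZero → key χ ≠ 0 := fun χ hχ => by
    simpa using hh₀ ⟨χ, hχ⟩
  obtain ⟨θ, hθ, hmax⟩ := Set.exists_max_image {χ : Weight ℂ H L | χ.IsNonZero} key
    (Set.toFinite _) hne
  have hneg : ∀ χ : Weight ℂ H L, key (-χ) = - key χ := fun χ => by simp [key]
  have hθpos : 0 < key θ := by
    have h1 := hmax (-θ) (Weight.IsNonZero.neg hθ)
    rw [hneg] at h1
    exact lt_of_le_of_ne (by linarith) (hkey θ hθ).symm
  have hvanish : ∀ (μ : H → ℂ) (w : L), w ∈ rootSpace H μ → key θ < |(μ h₀).re| → w = 0 := by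
    intro μ w hw hlt
    by_contra hw0
    let χ : Weight ℂ H L := ⟨μ, fun hbot => hw0 (by simpa [hbot] using hw)⟩
    have hχμ : key χ = (μ h₀).re := rfl
    have hχ : χ.IsNonZero := by
      intro h0
      have : μ h₀ = 0 := congrFun h0 h₀
      rw [this] at hlt
      simp at hlt
      linarith
    have h1 := hmax χ hχ
    have h2 := hmax (-χ) (Weight.IsNonZero.neg hχ)
    rw [hneg] at h2
    rw [← hχμ] at hlt
    exact absurd hlt (not_lt.mpr (abs_le.mpr ⟨by linarith, h1⟩))
  obtain ⟨h, e, f, ht, he, hf⟩ := IsKilling.exists_isSl2Triple_of_weight_isNonZero hθ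
  have hhH : h ∈ H := by
    have := lie_mem_genWeightSpace_of_mem_genWeightSpace he hf
    rw [ht.lie_e_f, add_neg_cancel] at this
    exact hzero h this
  have hfw : ∀ t : H, ⁅(t : L), f⁆ = (-θ : H → ℂ) t • f := fun t =>
    IsKilling.lie_eq_smul_of_mem_rootSpace hf t
  have hdich : ∀ (χ : Weight ℂ H L), χ.IsNonZero → ∀ x ∈ genWeightSpace L χ,
      ⁅x, e⁆ = 0 ∨ ⁅x, f⁆ = 0 := by
    intro χ hχ x hx
    rcases lt_or_gt_of_ne (hkey χ hχ) with hk | hk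
    · right
      refine hvanish _ _ (lie_mem_genWeightSpace_of_mem_genWeightSpace hx hf) ?_
      have : ((χ + -θ : H → ℂ) h₀).re = key χ - key θ := by simp [key, sub_eq_add_neg]
      rw [this, abs_of_neg (by linarith)]
      linarith
    · left
      refine hvanish _ _ (lie_mem_genWeightSpace_of_mem_genWeightSpace hx he) ?_
      have : ((χ + θ : H → ℂ) h₀).re = key χ + key θ := by simp [key]
      rw [this, abs_of_pos (by linarith)]
      linarith
  refine ⟨H, (-θ : H → ℂ), ⟨h, hhH⟩, e, f, ht, ?_, hfw, ?_, ?_⟩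
  · intro t
    exact congrArg Subtype.val (trivial_lie_zero H H t ⟨h, hhH⟩)
  · intro w hw
    have hw' : w ∈ rootSpace H (-θ : H → ℂ) := by
      apply weightSpace_le_genWeightSpace
      rw [mem_weightSpace]
      exact hw
    have h1 := IsKilling.finrank_rootSpace_eq_one (-θ) (Weight.IsNonZero.neg hθ)
    obtain ⟨c, hc⟩ := (finrank_eq_one_iff_of_nonzero' (⟨f, hf⟩ : rootSpace H (-θ : H → ℂ))
      (by simpa [Subtype.ext_iff] using ht.f_ne_zero)).mp h1 ⟨w, hw'⟩
    exact ⟨c, (congrArg Subtype.val hc).symm⟩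
  · intro M hfM hM
    let P : Set (Submodule ℂ L) := {N | f ∈ N ∧ ∀ x : L, ⁅x, e⁆ = 0 → ∀ m ∈ N, ⁅x, m⁆ ∈ N}
    let M₀ : Submodule ℂ L := sInf P
    have hfM₀ : f ∈ M₀ := by
      rw [Submodule.mem_sInf]; exact fun N hN => hN.1
    have hM₀ : ∀ x : L, ⁅x, e⁆ = 0 → ∀ m ∈ M₀, ⁅x, m⁆ ∈ M₀ := by
      intro x hx m hm
      rw [Submodule.mem_sInf] at hm ⊢
      exact fun N hN => hN.2 x hx m (hm N hN)
    let M₁ : Submodule ℂ L :=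
      { carrier := {m | m ∈ M₀ ∧ ∀ x : L, ⁅x, m⁆ ∈ M₀}
        add_mem' := fun {a b} ha hb => ⟨M₀.add_mem ha.1 hb.1, fun x => by
          rw [lie_add]; exact M₀.add_mem (ha.2 x) (hb.2 x)⟩
        zero_mem' := ⟨M₀.zero_mem, fun x => by rw [lie_zero]; exact M₀.zero_mem⟩
        smul_mem' := fun c a ha => ⟨M₀.smul_mem c ha.1, fun x => by
          rw [lie_smul]; exact M₀.smul_mem c (ha.2 x)⟩ }
    have hM₁ : M₁ ∈ P := by
      refine ⟨⟨hfM₀, fun x => ?_⟩, fun x hx m hm => ⟨hM₀ x hx m hm.1, fun y => ?_⟩⟩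
      · have hx : x ∈ ⨆ χ : Weight ℂ H L, (genWeightSpace L χ).toSubmodule := by
          rw [← LieSubmodule.iSup_toSubmodule, htop]; trivial
        induction hx using Submodule.iSup_induction' with
        | mem χ x hx =>
          by_cases hχ : χ.IsZero
          · rw [hχ.eq] at hx
            rw [hfw ⟨x, hzero x hx⟩]
            exact M₀.smul_mem _ hfM₀
          · rcases hdich χ hχ x hx with h0 | h0
            · exact hM₀ x h0 f hfM₀
            · rw [h0]; exact M₀.zero_mem
        | zero => rw [zero_lie]; exact M₀.zero_mem
        | add a b _ _ ha hb => rw [add_lie]; exact M₀.add_mem ha hb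
      · rw [leibniz_lie]
        exact M₀.add_mem (hm.2 _) (hM₀ x hx _ (hm.2 y))
    have hle : M₀ ≤ M₁ := sInf_le hM₁
    let I : LieIdeal ℂ L := { M₀ with lie_mem := fun {x m} hm => (hle hm).2 x }
    have hI : I = ⊤ := (IsSimple.eq_bot_or_eq_top I).resolve_left fun hbot => by
      have : f ∈ I := hfM₀
      rw [hbot] at this
      exact ht.f_ne_zero (by simpa using this)
    rw [eq_top_iff]
    intro x _
    have hx : x ∈ I := by rw [hI]; trivial
    exact (sInf_le (show M ∈ P from ⟨hfM, hM⟩) : M₀ ≤ M) hx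

/-- Simultaneous eigenvectors in a scalar extension, for a one-dimensional joint eigenspace. -/
theorem TensorProduct.exists_eq_tmul_of_forall_lTensor_eq_smul
    {K V R T : Type*} [Field K] [AddCommGroup V] [Module K V] [AddCommGroup R] [Module K R]
    (φ : T → V →ₗ[K] V) (α : T → K) (f : V)
    (hf : ∀ w : V, (∀ t, φ t w = α t • w) → ∃ c : K, w = c • f)
    (w : R ⊗[K] V) (hw : ∀ t, (φ t).lTensor R w = α t • w) : ∃ r : R, w = r ⊗ₜ[K] f := by
  classical
  let b := Module.Basis.ofVectorSpace K R
  obtain ⟨c, rfl⟩ := (TensorProduct.equivFinsuppOfBasisLeft (M := R) (N := V) b).symm.surjective w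
  have hc : ∀ i, ∃ a : K, c i = a • f := by
    intro i
    refine hf _ fun t => ?_
    have h1 := hw t
    have h2 : (φ t).lTensor R ((TensorProduct.equivFinsuppOfBasisLeft (N := V) b).symm c) =
        (TensorProduct.equivFinsuppOfBasisLeft (N := V) b).symm
          (c.mapRange (φ t) (map_zero _)) := by
      rw [TensorProduct.equivFinsuppOfBasisLeft_symm_apply,
        TensorProduct.equivFinsuppOfBasisLeft_symm_apply, Finsupp.sum_mapRange_index (by simp)]
      simp [Finsupp.sum]
    rw [h2, ← map_smul] at h1
    exact DFunLike.congr_fun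
      ((TensorProduct.equivFinsuppOfBasisLeft (N := V) b).symm.injective h1) i
  choose a ha using hc
  refine ⟨∑ i ∈ c.support, a i • b i, ?_⟩
  rw [TensorProduct.equivFinsuppOfBasisLeft_symm_apply, Finsupp.sum, TensorProduct.sum_tmul]
  refine Finset.sum_congr rfl fun i _ => ?_
  rw [ha, TensorProduct.tmul_smul, TensorProduct.smul_tmul']

/-- A simple complex Lie algebra has, up to scalars, only one invariant alternating product:
the bracket. -/
theorem LieAlgebra.IsSimple.exists_eq_tmul_lie
    {L : Type*} [LieRing L] [LieAlgebra ℂ L] [FiniteDimensional ℂ L] [LieAlgebra.IsSimple ℂ L]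
    {R : Type*} [CommRing R] [Algebra ℂ R] (B : L →ₗ[ℂ] L →ₗ[ℂ] R ⊗[ℂ] L)
    (halt : ∀ x, B x x = 0)
    (hB : ∀ z x y : L, ⁅(1 : R) ⊗ₜ[ℂ] z, B x y⁆ = B ⁅z, x⁆ y + B x ⁅z, y⁆) :
    ∃ r : R, ∀ x y : L, B x y = r ⊗ₜ[ℂ] ⁅x, y⁆ := by
  obtain ⟨H, α, h, e, f, ht, hth, htf, huniq, hgen⟩ :=
    LieAlgebra.IsSimple.exists_extremal_isSl2Triple L
  have hlT : ∀ (z : L) (w : R ⊗[ℂ] L),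
      (LieAlgebra.ad ℂ L z : L →ₗ[ℂ] L).lTensor R w = ⁅(1 : R) ⊗ₜ[ℂ] z, w⁆ := by
    intro z w
    induction w with
    | zero => simp
    | tmul r x => simp
    | add a b ha hb => rw [map_add, ha, hb, lie_add]
  obtain ⟨r, hr⟩ := TensorProduct.exists_eq_tmul_of_forall_lTensor_eq_smul
    (fun t : H => (LieAlgebra.ad ℂ L (t : L) : L →ₗ[ℂ] L)) α f huniq (B f h) (fun t => by
      rw [hlT, hB, hth, htf]; simp)
  have hef : B e f = ((1 / 2 : ℂ) • r) ⊗ₜ[ℂ] ⁅e, f⁆ := by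
    have h1 := hB e f h
    have h2 : ⁅e, (h : L)⁆ = (-2 : ℂ) • e := by
      rw [← lie_skew, ht.lie_h_e_smul ℂ, neg_smul]
    have h3 : B f e = - B e f := by
      have := halt (e + f)
      simp only [map_add, LinearMap.add_apply, halt, zero_add, add_zero] at this
      exact eq_neg_of_add_eq_zero_left this
    rw [hr, ht.lie_e_f, halt, zero_add, h2, map_smul, h3, LieAlgebra.ExtendScalars.bracket_tmul,
      one_mul, ht.lie_e_f] at h1
    rw [ht.lie_e_f, ← TensorProduct.smul_tmul', h1, smul_neg, neg_smul, neg_neg, smul_smul]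
    norm_num
  set s := (1 / 2 : ℂ) • r
  let C : L →ₗ[ℂ] L →ₗ[ℂ] R ⊗[ℂ] L :=
    B - (LieModule.toEnd ℂ L L : L →ₗ[ℂ] L →ₗ[ℂ] L).compr₂ (TensorProduct.mk ℂ R L s)
  have hCdef : ∀ x y, C x y = B x y - s ⊗ₜ[ℂ] ⁅x, y⁆ := fun x y => rfl
  have hC : ∀ z x y : L, ⁅(1 : R) ⊗ₜ[ℂ] z, C x y⁆ = C ⁅z, x⁆ y + C x ⁅z, y⁆ := by
    intro z x y
    rw [hCdef, hCdef, hCdef, lie_sub, hB, LieAlgebra.ExtendScalars.bracket_tmul, one_mul,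
      leibniz_lie, TensorProduct.tmul_add]
    abel
  have hCe : LinearMap.ker (C e) = ⊤ := by
    refine hgen _ (by rw [LinearMap.mem_ker, hCdef, hef, sub_self]) fun x hx m hm => ?_
    rw [LinearMap.mem_ker] at hm ⊢
    have := hC x e m
    rw [hm, hx, lie_zero, map_zero, LinearMap.zero_apply, zero_add] at this
    exact this.symm
  let I : LieIdeal ℂ L :=
    { LinearMap.ker C with
      lie_mem := fun {x m} hm => by
        have hm : C m = 0 := hm
        change C ⁅x, m⁆ = 0
        ext y
        have := hC x m y
        rw [hm, LinearMap.zero_apply, LinearMap.zero_apply, lie_zero, add_zero] at this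
        exact this.symm }
  have hI : I = ⊤ := (IsSimple.eq_bot_or_eq_top I).resolve_left fun hbot => by
    have : e ∈ I := LinearMap.ker_eq_top.mp hCe
    rw [hbot] at this
    exact ht.e_ne_zero (by simpa using this)
  refine ⟨s, fun x y => ?_⟩
  have hx : x ∈ I := by rw [hI]; trivial
  have hx : C x = 0 := hx
  rw [← sub_eq_zero, ← hCdef, hx, LinearMap.zero_apply]

/-- The version of `LieAlgebra.IsSimple.exists_eq_tmul_lie` for products that are bilinear over
the extended scalars. -/
theorem LieAlgebra.IsSimple.exists_eq_smul_lie
    {L : Type*} [LieRing L] [LieAlgebra ℂ L] [FiniteDimensional ℂ L] [LieAlgebra.IsSimple ℂ L]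
    {R : Type*} [CommRing R] [Algebra ℂ R]
    (β : R ⊗[ℂ] L →ₗ[R] R ⊗[ℂ] L →ₗ[R] R ⊗[ℂ] L) (halt : ∀ x, β x x = 0)
    (hβ : ∀ z x y : R ⊗[ℂ] L, ⁅z, β x y⁆ = β ⁅z, x⁆ y + β x ⁅z, y⁆) :
    ∃ r : R, ∀ x y : R ⊗[ℂ] L, β x y = r • ⁅x, y⁆ := by
  let B : L →ₗ[ℂ] L →ₗ[ℂ] R ⊗[ℂ] L := LinearMap.mk₂ ℂ
    (fun x y => β (1 ⊗ₜ x) (1 ⊗ₜ y))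
    (fun x x' y => by rw [TensorProduct.tmul_add, map_add, LinearMap.add_apply])
    (fun c x y => by
      rw [TensorProduct.tmul_smul, LinearMap.map_smul_of_tower, LinearMap.smul_apply])
    (fun x y y' => by rw [TensorProduct.tmul_add, map_add])
    (fun c x y => by rw [TensorProduct.tmul_smul, LinearMap.map_smul_of_tower])
  obtain ⟨r, hr⟩ := LieAlgebra.IsSimple.exists_eq_tmul_lie B (fun x => halt _) (fun z x y => by
    change ⁅(1 : R) ⊗ₜ[ℂ] z, β (1 ⊗ₜ x) (1 ⊗ₜ y)⁆ =
      β (1 ⊗ₜ ⁅z, x⁆) (1 ⊗ₜ y) + β (1 ⊗ₜ x) (1 ⊗ₜ ⁅z, y⁆)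
    rw [hβ, LieAlgebra.ExtendScalars.bracket_tmul, LieAlgebra.ExtendScalars.bracket_tmul, one_mul])
  have hr' : ∀ x y : L, β (1 ⊗ₜ x) (1 ⊗ₜ y) = r ⊗ₜ[ℂ] ⁅x, y⁆ := hr
  refine ⟨r, fun x y => ?_⟩
  induction x with
  | zero => simp
  | add a b ha hb => rw [map_add, LinearMap.add_apply, ha, hb, add_lie, smul_add]
  | tmul p x =>
    induction y with
    | zero => simp
    | add a b ha hb => rw [map_add, ha, hb, lie_add, smul_add]
    | tmul q y =>
      have hp : p ⊗ₜ[ℂ] x = p • ((1 : R) ⊗ₜ[ℂ] x) := by simp [TensorProduct.smul_tmul']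
      have hq : q ⊗ₜ[ℂ] y = q • ((1 : R) ⊗ₜ[ℂ] y) := by simp [TensorProduct.smul_tmul']
      rw [LieAlgebra.ExtendScalars.bracket_tmul, hp, hq, LinearMap.map_smul₂, map_smul,
        hr', TensorProduct.smul_tmul', TensorProduct.smul_tmul', TensorProduct.smul_tmul']
      congr 1
      simp only [smul_eq_mul]
      ring

/-- The product on `M × M` obtained from `M[t]/(t² - b t - a)`. -/
def quadraticBracket {S M : Type*} [CommRing S] [LieRing M] [LieAlgebra S M] (a b : S)
    (u v : M × M) : M × M :=
  (⁅u.1, v.1⁆ + a • ⁅u.2, v.2⁆, ⁅u.1, v.2⁆ + ⁅u.2, v.1⁆ + b • ⁅u.2, v.2⁆)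

/-- An extension of the `𝔤`-module structure on `𝔤 × 𝔤` to a Lie algebra is a quadratic one. -/
theorem exists_lie_eq_quadraticBracket
    {L : Type*} [LieRing L] [LieAlgebra ℂ L] [FiniteDimensional ℂ L] [LieAlgebra.IsSimple ℂ L]
    {R : Type*} [CommRing R] [Algebra ℂ R] {A : Type*} [LieRing A] [LieAlgebra R A]
    (e : ((R ⊗[ℂ] L) × (R ⊗[ℂ] L)) ≃ₗ[R] A)
    (h1 : ∀ x y : R ⊗[ℂ] L, ⁅e (x, 0), e (y, 0)⁆ = e (⁅x, y⁆, 0))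
    (h2 : ∀ x y : R ⊗[ℂ] L, ⁅e (x, 0), e (0, y)⁆ = e (0, ⁅x, y⁆)) :
    ∃ a b : R, ∀ u v, ⁅e u, e v⁆ = e (quadraticBracket a b u v) := by
  have hsplit : ∀ x y : R ⊗[ℂ] L, e (x, y) = e (x, 0) + e (0, y) := fun x y => by
    rw [← map_add]; simp
  let β : R ⊗[ℂ] L →ₗ[R] R ⊗[ℂ] L →ₗ[R] (R ⊗[ℂ] L) × (R ⊗[ℂ] L) := LinearMap.mk₂ R
    (fun x y => e.symm ⁅e (0, x), e (0, y)⁆)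
    (fun x x' y => by
      rw [← map_add, ← add_lie, ← map_add, Prod.mk_add_mk, add_zero])
    (fun c x y => by
      rw [← map_smul, ← smul_lie, ← map_smul, Prod.smul_mk, smul_zero])
    (fun x y y' => by
      rw [← map_add, ← lie_add, ← map_add, Prod.mk_add_mk, add_zero])
    (fun c x y => by
      rw [← map_smul, ← lie_smul, ← map_smul, Prod.smul_mk, smul_zero])
  have heβ : ∀ x y, e (β x y) = ⁅e (0, x), e (0, y)⁆ := fun x y => e.apply_symm_apply _
  have hβ : ∀ z x y : R ⊗[ℂ] L,
      (⁅z, (β x y).1⁆, ⁅z, (β x y).2⁆) = β ⁅z, x⁆ y + β x ⁅z, y⁆ := by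
    intro z x y
    apply e.injective
    rw [map_add, heβ, heβ, ← h2, ← h2, ← leibniz_lie, ← heβ,
      show β x y = ((β x y).1, (β x y).2) from rfl, hsplit (β x y).1, lie_add, h1, h2, ← hsplit]
  have hβalt : ∀ x, β x x = 0 := fun x => e.injective (by rw [heβ, lie_self, map_zero])
  obtain ⟨a, ha⟩ := LieAlgebra.IsSimple.exists_eq_smul_lie
    (β.compr₂ (LinearMap.fst R _ _)) (fun x => congrArg Prod.fst (hβalt x))
    (fun z x y => congrArg Prod.fst (hβ z x y))
  obtain ⟨b, hb⟩ := LieAlgebra.IsSimple.exists_eq_smul_lie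
    (β.compr₂ (LinearMap.snd R _ _)) (fun x => congrArg Prod.snd (hβalt x))
    (fun z x y => congrArg Prod.snd (hβ z x y))
  refine ⟨a, b, fun u v => ?_⟩
  obtain ⟨x, x'⟩ := u
  obtain ⟨y, y'⟩ := v
  have hβ' : β x' y' = (a • ⁅x', y'⁆, b • ⁅x', y'⁆) := Prod.ext (ha x' y') (hb x' y')
  have h3 : ⁅e (0, x'), e (y, 0)⁆ = e (0, ⁅x', y⁆) := by
    rw [← lie_skew, h2, ← map_neg, Prod.neg_mk, neg_zero, lie_skew]
  rw [hsplit x, hsplit y, lie_add, add_lie, add_lie, h1, h2, h3, ← heβ, hβ', ← map_add, ← map_add,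
    ← map_add]
  congr 1
  ext
  · simp [quadraticBracket]
  · simp [quadraticBracket]
    abel

/-- Quadratic brackets are compatible with base change. -/
theorem exists_baseChange_lie_eq_quadraticBracket
    {L : Type*} [LieRing L] [LieAlgebra ℂ L]
    {R : Type*} [CommRing R] [Algebra ℂ R] {A : Type*} [LieRing A] [LieAlgebra R A]
    (e : ((R ⊗[ℂ] L) × (R ⊗[ℂ] L)) ≃ₗ[R] A) (a b : R)
    (he : ∀ u v, ⁅e u, e v⁆ = e (quadraticBracket a b u v))
    (S : Type*) [CommRing S] [Algebra R S] [Algebra ℂ S] [IsScalarTower ℂ R S] :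
    ∃ ψ : (S ⊗[R] A) ≃ₗ[S] ((S ⊗[ℂ] L) × (S ⊗[ℂ] L)), ∀ u v : S ⊗[R] A,
      ψ ⁅u, v⁆ = quadraticBracket (algebraMap R S a) (algebraMap R S b) (ψ u) (ψ v) := by
  let κ := TensorProduct.AlgebraTensorModule.cancelBaseChange ℂ R S S L
  have hκ : ∀ (s s' : S) (x y : R ⊗[ℂ] L),
      κ ((s * s') ⊗ₜ ⁅x, y⁆) = ⁅κ (s ⊗ₜ x), κ (s' ⊗ₜ y)⁆ := by
    intro s s' x y
    induction x with
    | zero => simp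
    | add p q hp hq =>
      rw [add_lie, TensorProduct.tmul_add, TensorProduct.tmul_add, map_add, map_add, add_lie, hp, hq]
    | tmul r x =>
      induction y with
      | zero => simp
      | add p q hp hq =>
        rw [lie_add, TensorProduct.tmul_add, TensorProduct.tmul_add, map_add, map_add, lie_add, hp,
          hq]
      | tmul r' y =>
        simp only [κ, LieAlgebra.ExtendScalars.bracket_tmul,
          TensorProduct.AlgebraTensorModule.cancelBaseChange_tmul]
        congr 1
        simp only [Algebra.smul_def, map_mul]
        ring
  let ψ : (S ⊗[R] A) ≃ₗ[S] ((S ⊗[ℂ] L) × (S ⊗[ℂ] L)) :=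
    (TensorProduct.AlgebraTensorModule.congr (LinearEquiv.refl S S) e.symm).trans
      ((TensorProduct.prodRight R S S (R ⊗[ℂ] L) (R ⊗[ℂ] L)).trans (κ.prodCongr κ))
  have hψ : ∀ (s : S) (x : (R ⊗[ℂ] L) × (R ⊗[ℂ] L)),
      ψ (s ⊗ₜ e x) = (κ (s ⊗ₜ x.1), κ (s ⊗ₜ x.2)) := by
    intro s x
    simp [ψ]
  have hκa : ∀ (c : R) (s : S) (x : R ⊗[ℂ] L),
      κ (s ⊗ₜ (c • x)) = algebraMap R S c • κ (s ⊗ₜ x) := by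
    intro c s x
    rw [← map_smul, TensorProduct.smul_tmul', ← TensorProduct.smul_tmul, smul_eq_mul,
      Algebra.smul_def]
  refine ⟨ψ, fun u v => ?_⟩
  induction u with
  | zero => ext <;> simp [quadraticBracket]
  | add p q hp hq =>
    rw [add_lie, map_add, map_add, hp, hq]
    ext <;> simp [quadraticBracket] <;> abel
  | tmul s x =>
    induction v with
    | zero => ext <;> simp [quadraticBracket]
    | add p q hp hq =>
      rw [lie_add, map_add, map_add, hp, hq]
      ext <;> simp [quadraticBracket] <;> abel
    | tmul s' y =>
      obtain ⟨x, rfl⟩ := e.surjective x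
      obtain ⟨y, rfl⟩ := e.surjective y
      rw [LieAlgebra.ExtendScalars.bracket_tmul, he, hψ, hψ, hψ]
      simp only [quadraticBracket, TensorProduct.tmul_add, map_add, hκa, hκ]

/-- A monic quadratic with nonzero discriminant over a domain splits into distinct factors over a
finite type extension. -/
theorem exists_finiteType_add_eq_mul_eq_isUnit_sub
    {R : Type} [CommRing R] [IsDomain R] [Algebra ℂ R] (a b : R) (h : b ^ 2 + 4 * a ≠ 0) :
    ∃ (S : Type) (_ : CommRing S) (_ : Algebra R S), Nontrivial S ∧ Algebra.FiniteType R S ∧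
      ∃ t t' : S, t + t' = algebraMap R S b ∧ t * t' = - algebraMap R S a ∧ IsUnit (t - t') := by
  classical
  obtain ⟨F, _, _, _, hinj⟩ : ∃ (F : Type) (_ : Field F) (_ : Algebra R F),
      IsAlgClosed F ∧ Function.Injective (algebraMap R F) := by
    refine ⟨AlgebraicClosure (FractionRing R), inferInstance, inferInstance, inferInstance, ?_⟩
    rw [IsScalarTower.algebraMap_eq R (FractionRing R)]
    exact (algebraMap (FractionRing R) _).injective.comp (IsFractionRing.injective R _)
  obtain ⟨r, hr⟩ := IsAlgClosed.exists_pow_nat_eq (algebraMap R F (b ^ 2 + 4 * a)) two_pos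
  have h2 : (2 : F) ≠ 0 := by
    have := ((algebraMap R F).comp (algebraMap ℂ R)).injective.ne (two_ne_zero (α := ℂ))
    rwa [map_ofNat, map_zero] at this
  have hr0 : r ≠ 0 := by
    rintro rfl
    apply h
    apply hinj
    rw [← hr]
    simp
  simp only [map_add, map_mul, map_pow, map_ofNat] at hr
  let t : F := (algebraMap R F b + r) / 2
  let t' : F := (algebraMap R F b - r) / 2
  let S : Subalgebra R F := Algebra.adjoin R {t, t', r⁻¹}
  have hmem : ∀ x ∈ ({t, t', r⁻¹} : Set F), x ∈ S := fun x hx => Algebra.subset_adjoin hx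
  refine ⟨S, inferInstance, inferInstance, inferInstance, ?_, ⟨t, hmem t (by simp)⟩,
    ⟨t', hmem t' (by simp)⟩, ?_, ?_, ?_⟩
  · exact S.fg_iff_finiteType.mp ⟨{t, t', r⁻¹}, by simp [S]⟩
  · apply Subtype.ext
    change t + t' = algebraMap R F b
    simp only [t, t']
    field_simp
    ring
  · apply Subtype.ext
    change t * t' = - algebraMap R F a
    simp only [t, t']
    field_simp
    linear_combination - hr
  · refine IsUnit.of_mul_eq_one ⟨r⁻¹, hmem _ (by simp)⟩ ?_
    apply Subtype.ext
    change (t - t') * r⁻¹ = 1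
    simp only [t, t']
    field_simp
    ring

/-- If `X² - b X - a` has roots `t` and `t'` whose difference is invertible, the quadratic bracket is
the one of a direct product. -/
theorem exists_quadraticBracket_eq_prod {S M : Type*} [CommRing S] [LieRing M] [LieAlgebra S M]
    {a b t t' : S} (hadd : t + t' = b) (hmul : t * t' = -a) (hu : IsUnit (t - t')) :
    ∃ φ : (M × M) ≃ₗ[S] (M × M), ∀ u v,
      φ (quadraticBracket a b u v) = (⁅(φ u).1, (φ v).1⁆, ⁅(φ u).2, (φ v).2⁆) := by
  obtain ⟨c, hc⟩ := hu.exists_right_inv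
  let φ : (M × M) ≃ₗ[S] (M × M) :=
    { toFun := fun u => (u.1 + t • u.2, u.1 + t' • u.2)
      invFun := fun u => (u.1 - (t * c) • (u.1 - u.2), c • (u.1 - u.2))
      map_add' := fun u v => by ext <;> simp <;> module
      map_smul' := fun s u => by ext <;> simp <;> module
      left_inv := fun u => by
        have h : c • ((u.1 + t • u.2) - (u.1 + t' • u.2)) = u.2 := by
          calc _ = ((t - t') * c) • u.2 := by module
            _ = u.2 := by rw [hc, one_smul]
        ext
        · change u.1 + t • u.2 - (t * c) • ((u.1 + t • u.2) - (u.1 + t' • u.2)) = u.1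
          rw [mul_smul, h, add_sub_cancel_right]
        · exact h
      right_inv := fun u => by
        ext
        · change u.1 - (t * c) • (u.1 - u.2) + t • c • (u.1 - u.2) = u.1
          module
        · change u.1 - (t * c) • (u.1 - u.2) + t' • c • (u.1 - u.2) = u.2
          calc _ = u.1 - ((t - t') * c) • (u.1 - u.2) := by module
            _ = u.2 := by rw [hc, one_smul, sub_sub_cancel] }
  have hφ : ∀ u, φ u = (u.1 + t • u.2, u.1 + t' • u.2) := fun u => rfl
  refine ⟨φ, fun u v => ?_⟩
  obtain rfl : a = -(t * t') := by rw [hmul, neg_neg]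
  subst hadd
  rw [hφ, hφ, hφ]
  ext
  · simp only [quadraticBracket, lie_add, add_lie, lie_smul, smul_lie]
    module
  · simp only [quadraticBracket, lie_add, add_lie, lie_smul, smul_lie]
    module

/-- If `X² - b X - a` has a double root, the quadratic bracket is the Takiff bracket. -/
theorem exists_quadraticBracket_eq_takiffBracket {S M : Type*} [CommRing S] [LieRing M]
    [LieAlgebra S M] {a b t : S} (hadd : t + t = b) (hmul : t * t = -a) :
    ∃ φ : (M × M) ≃ₗ[S] (M × M), ∀ u v,
      φ (quadraticBracket a b u v) = takiffBracket (φ u) (φ v) := by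
  let φ : (M × M) ≃ₗ[S] (M × M) :=
    { toFun := fun u => (u.1 + t • u.2, u.2)
      invFun := fun u => (u.1 - t • u.2, u.2)
      map_add' := fun u v => by ext <;> simp; module
      map_smul' := fun s u => by ext <;> simp; module
      left_inv := fun u => by simp
      right_inv := fun u => by simp }
  have hφ : ∀ u, φ u = (u.1 + t • u.2, u.2) := fun u => rfl
  refine ⟨φ, fun u v => ?_⟩
  obtain rfl : a = -(t * t) := by rw [hmul, neg_neg]
  subst hadd
  rw [hφ, hφ, hφ]
  ext
  · simp only [quadraticBracket, takiffBracket, lie_add, add_lie, lie_smul, smul_lie]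
    module
  · simp only [quadraticBracket, takiffBracket, lie_add, add_lie, lie_smul, smul_lie]
    module

/-- Let `L` be a finite-dimensional simple Lie algebra over `ℂ`, `R` an integral domain which
is a `ℂ`-algebra, and `A` a Lie algebra over `R` whose underlying `R`-module is
`𝔤_R × 𝔤_R` (via `e`) with `[(x,0),(y,0)] = ([x,y],0)` and `[(x,0),(0,y)] = (0,[x,y])`.
Then there is a nonzero finite-type commutative `R`-algebra `S` such that the base change
`S ⊗[R] A` is isomorphic as a Lie algebra over `S` either to the direct product Lie algebra
`𝔤_S × 𝔤_S` or to the Takiff algebra `T(𝔤)_S`. -/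
theorem base_change_iso_direct_sum_or_takiff
    (L : Type) [LieRing L] [LieAlgebra ℂ L] [FiniteDimensional ℂ L]
    [LieAlgebra.IsSimple ℂ L]
    (R : Type) [CommRing R] [IsDomain R] [Algebra ℂ R]
    (A : Type) [LieRing A] [LieAlgebra R A]
    (e : ((R ⊗[ℂ] L) × (R ⊗[ℂ] L)) ≃ₗ[R] A)
    (h1 : ∀ x y : R ⊗[ℂ] L, ⁅e (x, 0), e (y, 0)⁆ = e (⁅x, y⁆, 0))
    (h2 : ∀ x y : R ⊗[ℂ] L, ⁅e (x, 0), e (0, y)⁆ = e (0, ⁅x, y⁆)) :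
    ∃ (S : Type) (_ : CommRing S) (_ : Algebra R S) (_ : Algebra ℂ S)
      (_ : IsScalarTower ℂ R S),
      Nontrivial S ∧ Algebra.FiniteType R S ∧
      ((∃ ψ : (S ⊗[R] A) ≃ₗ[S] ((S ⊗[ℂ] L) × (S ⊗[ℂ] L)),
          ∀ u v : S ⊗[R] A, ψ ⁅u, v⁆ = (⁅(ψ u).1, (ψ v).1⁆, ⁅(ψ u).2, (ψ v).2⁆)) ∨
        (∃ ψ : (S ⊗[R] A) ≃ₗ[S] ((S ⊗[ℂ] L) × (S ⊗[ℂ] L)),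
          ∀ u v : S ⊗[R] A, ψ ⁅u, v⁆ = takiffBracket (ψ u) (ψ v))) := by
  obtain ⟨a, b, hab⟩ := exists_lie_eq_quadraticBracket e h1 h2
  by_cases hD : b ^ 2 + 4 * a = 0
  · refine ⟨R, inferInstance, inferInstance, inferInstance, inferInstance, inferInstance,
      inferInstance, Or.inr ?_⟩
    obtain ⟨ψ, hψ⟩ := exists_baseChange_lie_eq_quadraticBracket e a b hab R
    let c : R := algebraMap ℂ R (1 / 2)
    have hc : 2 * c = 1 := by
      rw [← map_ofNat (algebraMap ℂ R) 2, ← map_mul]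
      norm_num
    obtain ⟨φ, hφ⟩ := exists_quadraticBracket_eq_takiffBracket (M := R ⊗[ℂ] L)
      (a := a) (b := b) (t := c * b) (by linear_combination b * hc)
      (by linear_combination c ^ 2 * hD - (2 * c + 1) * a * hc)
    exact ⟨ψ.trans φ, fun u v => by
      simp only [LinearEquiv.trans_apply, hψ, hφ, Algebra.algebraMap_self, RingHom.id_apply]⟩
  · obtain ⟨S, _, _, hS, hft, t, t', hadd, hmul, hu⟩ :=
      exists_finiteType_add_eq_mul_eq_isUnit_sub a b hD
    let : Algebra ℂ S := ((algebraMap R S).comp (algebraMap ℂ R)).toAlgebra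
    have : IsScalarTower ℂ R S := IsScalarTower.of_algebraMap_eq fun _ => rfl
    refine ⟨S, inferInstance, inferInstance, inferInstance, inferInstance, hS, hft, Or.inl ?_⟩
    obtain ⟨ψ, hψ⟩ := exists_baseChange_lie_eq_quadraticBracket e a b hab S
    obtain ⟨φ, hφ⟩ := exists_quadraticBracket_eq_prod (M := S ⊗[ℂ] L) hadd hmul hu
    exact ⟨ψ.trans φ, fun u v => by simp only [LinearEquiv.trans_apply, hψ, hφ]⟩
end

section
/- Let 𝔤 be a finite-dimensional simple Lie algebra over ℂ and k_a, k_b ∈ ℂ. The symmetric bilinear form k_a·κ_a + k_b·κ_b on the Takiff algebra T(𝔤) is nondegenerate if and only if k_b ≠ 0. -/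
/-- The bilinear form `κ_a((x,x'),(y,y')) = κ(x,y)` on the Takiff algebra,
where `κ` is the Killing form of `L`. -/
noncomputable def kappaA (L : Type*) [LieRing L] [LieAlgebra ℂ L] :
    (L × L) →ₗ[ℂ] (L × L) →ₗ[ℂ] ℂ :=
  LinearMap.mk₂ ℂ (fun u v => killingForm ℂ L u.1 v.1)
    (fun _ _ _ => by simp) (fun _ _ _ => by simp)
    (fun _ _ _ => by simp) (fun _ _ _ => by simp)

/-- The bilinear form `κ_b((x,x'),(y,y')) = κ(x,y') + κ(x',y)` on the Takiff algebra. -/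
noncomputable def kappaB (L : Type*) [LieRing L] [LieAlgebra ℂ L] :
    (L × L) →ₗ[ℂ] (L × L) →ₗ[ℂ] ℂ :=
  LinearMap.mk₂ ℂ (fun u v => killingForm ℂ L u.1 v.2 + killingForm ℂ L u.2 v.1)
    (fun _ _ _ => by simp; ring) (fun _ _ _ => by simp; ring)
    (fun _ _ _ => by simp; ring) (fun _ _ _ => by simp; ring)

/-- For a finite-dimensional simple Lie algebra `L` over `ℂ` and `k_a, k_b ∈ ℂ`, the
symmetric bilinear form `k_a·κ_a + k_b·κ_b` on the Takiff algebra `T(𝔤) = L × L` is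
nondegenerate if and only if `k_b ≠ 0`. -/
theorem ka_kappaA_add_kb_kappaB_nondegenerate_iff
    (L : Type*) [LieRing L] [LieAlgebra ℂ L] [FiniteDimensional ℂ L]
    [LieAlgebra.IsSimple ℂ L] (ka kb : ℂ) :
    (∀ u : L × L, (∀ v : L × L, (ka • kappaA L + kb • kappaB L) u v = 0) → u = 0) ↔
      kb ≠ 0 := by
  have hκ : ∀ x : L, (∀ y, killingForm ℂ L x y = 0) → x = 0 :=
    (LieAlgebra.IsKilling.killingForm_nondegenerate ℂ L).1
  constructor
  · rintro h rfl
    have : Nontrivial L := LieAlgebra.IsSimple.nontrivial ℂ L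
    obtain ⟨x, hx⟩ := exists_ne (0 : L)
    exact hx (congrArg Prod.snd (h (0, x) fun v => by simp [kappaA]))
  · rintro hkb ⟨x, x'⟩ h
    have hx : x = 0 := hκ x fun y => by simpa [kappaA, kappaB, hkb] using h (0, y)
    subst hx
    have hx' : x' = 0 := hκ x' fun y => by simpa [kappaA, kappaB, hkb] using h (y, 0)
    rw [hx', Prod.mk_zero_zero]
end
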